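/- arXiv:2305.11062 — 2 statements merged into one kernel-verified Lean document; each statement's English description precedes it below -/
import Mathlib

section
/- Let G be an abelian group with no elements of order 2, and let A, B be finite multisets of G. Write μ := μ_A − μ_B. Then FS(A) = FS(B) (equality of multisets) if and only if μ ∈ V(G) and Σ_{g∈G} μ(g)·g = 0. -/
open scoped BigOperators

/-- The multiset of all `2^|A|` subset sums of a finite multiset `A`. -/
def FS {G : Type*} [AddCommMonoid G] (A : Multiset G) : Multiset G :=
  A.powerset.map Multiset.sum

/-- `μ : G → ℤ` belongs to `V(G)`. -/
def memV {G : Type*} [AddCommGroup G] (μ : G → ℤ) : Prop :=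
  (Function.support μ).Finite ∧
  (∀ g : G, μ g + μ (-g) = μ (g + g) + μ (-(g + g))) ∧
  (∀ H : AddSubgroup G, ∑ᶠ g ∈ (H : Set G), μ g = 0)

section

open Filter Topology

theorem one_sub_mul_tsum (b : ℕ → ℝ) (w : ℂ) (hb : Summable fun m => (b m : ℂ) * w ^ (m + 1)) :
    (1 - w) * ∑' m, (b m : ℂ) * w ^ (m + 1) =
      b 0 * w + ∑' m, ((b (m + 1) - b m : ℝ) : ℂ) * w ^ (m + 2) := by
  have h1 : Summable fun m => (b (m + 1) : ℂ) * w ^ (m + 1 + 1) :=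
    (summable_nat_add_iff 1 (f := fun m => (b m : ℂ) * w ^ (m + 1))).2 hb
  have h2 : Summable fun m => (b m : ℂ) * w ^ (m + 2) := by
    refine (hb.mul_right w).congr fun m => ?_
    ring
  have h3 : w * ∑' m, (b m : ℂ) * w ^ (m + 1) = ∑' m, (b m : ℂ) * w ^ (m + 2) := by
    rw [← tsum_mul_left]
    exact tsum_congr fun m => by ring
  have h4 : ∑' m, ((b (m + 1) - b m : ℝ) : ℂ) * w ^ (m + 2) =
      ∑' m, (b (m + 1) : ℂ) * w ^ (m + 1 + 1) - ∑' m, (b m : ℂ) * w ^ (m + 2) := by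
    rw [← h1.tsum_sub h2]
    exact tsum_congr fun m => by push_cast; ring
  rw [sub_mul, one_mul, h3, h4, hb.tsum_eq_zero_add]
  ring

theorem abs_rpow_neg_sub_le {s : ℝ} (h1 : 1 ≤ s) (h2 : s ≤ 2) (m : ℕ) :
    |((m + 1 + 1 : ℕ) : ℝ) ^ (-s) - ((m + 1 : ℕ) : ℝ) ^ (-s)| ≤ 2 * ((m + 1 : ℕ) : ℝ) ^ (-2 : ℝ) := by
  have hx : (0 : ℝ) < (m + 1 : ℕ) := by positivity
  have hx1 : (1 : ℝ) ≤ (m + 1 : ℕ) := by exact_mod_cast Nat.succ_pos m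
  rw [Nat.cast_succ (m + 1)]
  generalize ((m + 1 : ℕ) : ℝ) = x at hx hx1
  have hle : (x + 1) ^ (-s) ≤ x ^ (-s) :=
    Real.rpow_le_rpow_of_nonpos hx (by linarith) (by linarith)
  rw [abs_sub_comm, abs_of_nonneg (by linarith)]
  have ht : (x + 1) ^ (-s) = x ^ (-s) * (x / (x + 1)) ^ s := by
    rw [Real.div_rpow hx.le (by linarith), Real.rpow_neg (by linarith), Real.rpow_neg hx.le]
    have := (Real.rpow_pos_of_pos hx s).ne'
    field_simp
  have hsq : (x / (x + 1)) ^ (2 : ℝ) ≤ (x / (x + 1)) ^ s :=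
    Real.rpow_le_rpow_of_exponent_ge (by positivity) (by rw [div_le_one (by linarith)]; linarith) h2
  have hb : 1 - 2 / x ≤ (x / (x + 1)) ^ (2 : ℝ) := by
    rw [Real.rpow_two, div_pow, sub_le_iff_le_add, div_add_div _ _ (by positivity) hx.ne',
      le_div_iff₀ (by positivity)]
    nlinarith
  have hd : x ^ (-s) ≤ x ^ (-1 : ℝ) :=
    Real.rpow_le_rpow_of_exponent_le hx1 (by linarith)
  have e2 : x ^ (-2 : ℝ) = x ^ (-1 : ℝ) * (1 / x) := by
    rw [Real.rpow_neg hx.le, Real.rpow_neg hx.le, Real.rpow_two, Real.rpow_one]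
    field_simp
  rw [ht, e2]
  have hp : 0 ≤ x ^ (-s) := Real.rpow_nonneg hx.le _
  have h2x : 0 ≤ 2 / x := by positivity
  calc x ^ (-s) - x ^ (-s) * (x / (x + 1)) ^ s = x ^ (-s) * (1 - (x / (x + 1)) ^ s) := by ring
    _ ≤ x ^ (-s) * (2 / x) := by
        apply mul_le_mul_of_nonneg_left _ hp
        linarith
    _ ≤ x ^ (-1 : ℝ) * (2 / x) := mul_le_mul_of_nonneg_right hd h2x
    _ = _ := by ring

theorem summable_two_mul_rpow :
    Summable fun m : ℕ => 2 * ((m + 1 : ℕ) : ℝ) ^ (-2 : ℝ) :=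
  (((summable_nat_add_iff 1).2 (Real.summable_nat_rpow.2 (by norm_num : (-2 : ℝ) < -1)))).mul_left 2

theorem tendsto_LSeries_pow {w : ℂ} (hw : ‖w‖ = 1) (hw1 : w ≠ 1) :
    Tendsto (fun s : ℝ => LSeries (fun m => w ^ m) s) (𝓝[>] 1) (𝓝 (-Complex.log (1 - w))) := by
  let b : ℝ → ℕ → ℝ := fun s m => ((m + 1 : ℕ) : ℝ) ^ (-s)
  let R : ℂ := b 1 0 * w + ∑' m, ((b 1 (m + 1) - b 1 m : ℝ) : ℂ) * w ^ (m + 2)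
  have hslit : 1 - w ∈ Complex.slitPlane := by
    rw [Complex.mem_slitPlane_iff]
    by_contra! hcon
    have him : w.im = 0 := by simpa using hcon.2
    have hre : 1 ≤ w.re := by simpa using hcon.1
    have := Complex.re_le_norm w
    exact hw1 (Complex.ext (by simp; linarith) (by simpa using him))
  have hR : R = (1 - w) * -Complex.log (1 - w) := by
    have hc : Tendsto (fun r : ℝ => (1 - r * w) * -Complex.log (1 - r * w)) (𝓝[<] 1)
        (𝓝 ((1 - w) * -Complex.log (1 - w))) := by
      have h0 : ContinuousAt (fun r : ℝ => (1 - r * w) * -Complex.log (1 - r * w)) 1 := by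
        apply ContinuousAt.mul (by fun_prop)
        apply ContinuousAt.neg
        apply ContinuousAt.clog (by fun_prop)
        simpa using hslit
      have h1 := h0.tendsto.mono_left (nhdsWithin_le_nhds (s := Set.Iio 1))
      simpa using h1
    have hd : Tendsto (fun r : ℝ => b 1 0 * (r * w) +
        ∑' m, ((b 1 (m + 1) - b 1 m : ℝ) : ℂ) * (r * w) ^ (m + 2)) (𝓝[<] 1) (𝓝 R) := by
      apply Tendsto.add
      · have h0 : ContinuousAt (fun r : ℝ => (b 1 0 : ℂ) * (r * w)) 1 := by fun_prop
        have h1 := h0.tendsto.mono_left (nhdsWithin_le_nhds (s := Set.Iio 1))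
        simpa using h1
      · apply tendsto_tsum_of_dominated_convergence summable_two_mul_rpow
        · intro m
          have h0 : ContinuousAt
            (fun r : ℝ => ((b 1 (m + 1) - b 1 m : ℝ) : ℂ) * (r * w) ^ (m + 2)) 1 := by fun_prop
          have h1 := h0.tendsto.mono_left (nhdsWithin_le_nhds (s := Set.Iio 1))
          simpa using h1
        · filter_upwards [Ioo_mem_nhdsLT (zero_lt_one' ℝ)] with r hr m
          rw [norm_mul, norm_pow, norm_mul, hw, Complex.norm_real, Complex.norm_real]
          refine (mul_le_of_le_one_right (norm_nonneg _) ?_).trans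
            (abs_rpow_neg_sub_le le_rfl (by norm_num) m)
          apply pow_le_one₀ (by positivity)
          rw [Real.norm_of_nonneg hr.1.le, mul_one]
          exact hr.2.le
    refine tendsto_nhds_unique_of_eventuallyEq hd hc ?_
    filter_upwards [Ioo_mem_nhdsLT (zero_lt_one' ℝ)] with r hr
    have hn : ‖(r : ℂ) * w‖ < 1 := by
      rw [norm_mul, hw, mul_one, Complex.norm_real, Real.norm_of_nonneg hr.1.le]
      exact hr.2
    have hs := Complex.hasSum_taylorSeries_neg_log hn
    have hs' : HasSum (fun m : ℕ => (b 1 m : ℂ) * (r * w) ^ (m + 1))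
        (-Complex.log (1 - r * w)) := by
      rw [← hasSum_nat_add_iff' 1] at hs
      simp only [Finset.range_one, Finset.sum_singleton, Nat.cast_zero, div_zero, sub_zero] at hs
      refine hs.congr_fun ?_ 
      intro m
      simp only [b]
      rw [Real.rpow_neg_one]
      push_cast
      field_simp
    rw [← hs'.tsum_eq, one_sub_mul_tsum _ _ hs'.summable]
  have hmain : Tendsto (fun s : ℝ => (1 - w) * LSeries (fun m => w ^ m) s) (𝓝[>] 1) (𝓝 R) := by
    have hd : Tendsto (fun s : ℝ => b s 0 * w +
        ∑' m, ((b s (m + 1) - b s m : ℝ) : ℂ) * w ^ (m + 2)) (𝓝[>] 1) (𝓝 R) := by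
      have hcont : ∀ m, ContinuousAt (fun s => b s m) 1 := fun m => by
        have : ((m + 1 : ℕ) : ℝ) ≠ 0 := by positivity
        simp only [b]
        exact ContinuousAt.rpow continuousAt_const (by fun_prop) (Or.inl this)
      apply Tendsto.add
      · have h0 : ContinuousAt (fun s : ℝ => (b s 0 : ℂ) * w) 1 :=
          (Complex.continuous_ofReal.continuousAt.comp (hcont 0)).mul continuousAt_const
        exact h0.tendsto.mono_left nhdsWithin_le_nhds
      · apply tendsto_tsum_of_dominated_convergence summable_two_mul_rpow
        · intro m
          have h0 : ContinuousAt
              (fun s : ℝ => ((b s (m + 1) - b s m : ℝ) : ℂ) * w ^ (m + 2)) 1 :=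
            (Complex.continuous_ofReal.continuousAt.comp
              ((hcont (m + 1)).sub (hcont m))).mul continuousAt_const
          exact h0.tendsto.mono_left nhdsWithin_le_nhds
        · filter_upwards [Ioo_mem_nhdsGT (one_lt_two : (1 : ℝ) < 2)] with s hs m
          rw [norm_mul, norm_pow, hw, one_pow, mul_one, Complex.norm_real]
          exact abs_rpow_neg_sub_le hs.1.le hs.2.le m
    refine hd.congr' ?_
    filter_upwards [self_mem_nhdsWithin] with s (hs : 1 < s)
    have hsum : LSeriesSummable (fun m => w ^ m) s :=
      LSeriesSummable_of_bounded_of_one_lt_re (m := 1) (fun m _ => by simp [hw]) (by simpa using hs)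
    have hterm : ∀ m : ℕ, LSeries.term (fun m => w ^ m) s (m + 1) = (b s m : ℂ) * w ^ (m + 1) := by
      intro m
      rw [LSeries.term_of_ne_zero (Nat.succ_ne_zero m)]
      simp only [b]
      rw [Complex.ofReal_cpow (by positivity), Complex.ofReal_neg, Complex.cpow_neg]
      push_cast
      field_simp
    have hS : Summable fun m => (b s m : ℂ) * w ^ (m + 1) :=
      ((summable_nat_add_iff 1).2 hsum).congr hterm
    rw [← one_sub_mul_tsum _ _ hS, LSeries, hsum.tsum_eq_zero_add, LSeries.term_zero, zero_add,
      tsum_congr hterm]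
  have hw0 : 1 - w ≠ 0 := sub_ne_zero.2 hw1.symm
  have := hmain.const_mul (1 - w)⁻¹
  rw [hR] at this
  simpa [← mul_assoc, inv_mul_cancel₀ hw0] using this

theorem LSeries_ite_dvd {p : ℕ} (hp : p ≠ 0) (f : ℕ → ℂ) (s : ℂ) :
    LSeries (fun m => if p ∣ m then f m else 0) s =
      (p : ℂ) ^ (-s) * LSeries (fun m => f (p * m)) s := by
  rw [LSeries, LSeries, ← tsum_mul_left,
    ← (mul_right_injective₀ hp).tsum_eq (f := LSeries.term (fun m => if p ∣ m then f m else 0) s)]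
  · refine tsum_congr fun m => ?_
    rcases eq_or_ne m 0 with rfl | hm
    · simp
    · rw [LSeries.term_of_ne_zero (mul_ne_zero hp hm), LSeries.term_of_ne_zero hm,
        if_pos (dvd_mul_right p m), Nat.cast_mul, Complex.natCast_mul_natCast_cpow,
        Complex.cpow_neg]
      ring
  · intro m hm
    by_contra hcon
    apply hm
    have : ¬ p ∣ m := fun ⟨c, hc⟩ => hcon ⟨c, hc.symm⟩
    simp [LSeries.term, this]

theorem LSeries_neg_one_pow_mul {n : ℕ} [NeZero n] (ψ : DirichletCharacter ℂ n) {s : ℝ}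
    (hs : 1 < s) :
    LSeries (fun m => (-1) ^ m * ψ m) s =
      -(1 - (2 : ℂ) ^ (1 - (s : ℂ)) * ψ 2) * ψ.LFunction s := by
  have hs' : 1 < (s : ℂ).re := by simpa using hs
  have hψ : LSeriesSummable (ψ ·) s :=
    LSeriesSummable_of_bounded_of_one_lt_real (m := 1) (fun m _ => ψ.norm_le_one _) hs
  have h2 : LSeriesSummable (fun m : ℕ => if 2 ∣ m then ψ m else 0) s := by
    refine LSeriesSummable_of_bounded_of_one_lt_real (m := 1) (fun m _ => ?_) hs
    split_ifs
    · exact ψ.norm_le_one _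
    · simp
  have hf : (fun m : ℕ => (-1) ^ m * ψ m) =
      (2 : ℂ) • (fun m : ℕ => if 2 ∣ m then ψ m else 0) - fun m : ℕ => ψ m := by
    ext m
    by_cases hm : 2 ∣ m
    · rw [(even_iff_two_dvd.2 hm).neg_one_pow]
      simp [hm]
      ring
    · rw [Odd.neg_one_pow (by rwa [← Nat.not_even_iff_odd, even_iff_two_dvd])]
      simp [hm]
  have hdbl : (fun m : ℕ => ψ ((2 * m : ℕ) : ZMod n)) = (ψ 2) • fun m : ℕ => ψ m := by
    ext m
    simp
  rw [hf, LSeries_sub (h2.smul _) hψ, LSeries_smul, LSeries_ite_dvd two_ne_zero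
    (fun m : ℕ => ψ m), hdbl, LSeries_smul, ψ.LFunction_eq_LSeries hs', sub_eq_add_neg 1 (s : ℂ),
    Complex.cpow_add _ _ two_ne_zero]
  simp only [Nat.cast_ofNat, Complex.cpow_one]
  ring

theorem tendsto_ofReal_nhdsGT : Tendsto (fun s : ℝ => (s : ℂ)) (𝓝[>] 1) (𝓝[≠] 1) := by
  apply tendsto_nhdsWithin_of_tendsto_nhds_of_eventually_within
  · simpa using (Complex.continuous_ofReal.tendsto 1).mono_left nhdsWithin_le_nhds
  · filter_upwards [self_mem_nhdsWithin] with s (hs : 1 < s)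
    simpa using hs.ne'

theorem apply_two_mul_eq_of_tendsto {n : ℕ} [NeZero n] (hn : Odd n) (ψ : DirichletCharacter ℂ n)
    (x : ℂ)
    (h : Tendsto (fun s : ℝ => LSeries (fun m => (-1) ^ m * ψ m) s * x) (𝓝[>] 1) (𝓝 0)) :
    ψ 2 * x = x ∧ (ψ = 1 → x = 0) := by
  have hcong : (fun s : ℝ => LSeries (fun m => (-1) ^ m * ψ m) s * x) =ᶠ[𝓝[>] 1]
      fun s : ℝ => -(1 - (2 : ℂ) ^ (1 - (s : ℂ)) * ψ 2) * ψ.LFunction s * x := by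
    filter_upwards [self_mem_nhdsWithin] with s (hs : 1 < s)
    rw [LSeries_neg_one_pow_mul ψ hs]
  replace h := h.congr' hcong
  by_cases hψ : ψ = 1
  · subst hψ
    suffices hx : x = 0 by simp [hx]
    have hu : (1 : DirichletCharacter ℂ n) 2 = 1 := by
      refine MulChar.one_apply ?_
      have := (ZMod.unitOfCoprime 2 (Nat.coprime_two_left.2 hn)).isUnit
      simpa using this
    rw [hu] at h
    have hslope : Tendsto (fun z : ℂ => (z - 1)⁻¹ * (1 - (2 : ℂ) ^ (1 - z))) (𝓝[≠] 1)
        (𝓝 (Complex.log 2)) := by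
      have hd : HasDerivAt (fun z : ℂ => 1 - (2 : ℂ) ^ (1 - z)) (Complex.log 2) 1 := by
        have h1 : HasDerivAt (fun z : ℂ => 1 - z) (-1) 1 := by
          simpa using (hasDerivAt_id (1 : ℂ)).const_sub 1
        have h2 := (h1.const_cpow (c := 2) (Or.inl two_ne_zero)).const_sub 1
        simpa using h2
      have := hd.tendsto_slope
      refine this.congr fun z => ?_
      simp [slope]
    have hL := DirichletCharacter.LFunctionTrivChar_residue_one (N := n)
    have h3 := (((hslope.mul hL).comp tendsto_ofReal_nhdsGT).neg).mul_const x
    have h4 := tendsto_nhds_unique_of_eventuallyEq h3 h (by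
      filter_upwards [self_mem_nhdsWithin] with s (hs : 1 < s)
      have : (s : ℂ) - 1 ≠ 0 := by
        rw [sub_ne_zero]
        simpa using hs.ne'
      simp only [Function.comp]
      field_simp)
    have hlog : Complex.log 2 ≠ 0 := by
      have h2 : Complex.log 2 = (Real.log 2 : ℝ) := by simp
      rw [h2]
      exact_mod_cast (Real.log_pos one_lt_two).ne'
    have hprod : ∏ p ∈ n.primeFactors, (1 - (p : ℂ)⁻¹) ≠ 0 := by
      refine Finset.prod_ne_zero_iff.2 fun p hp h0 => ?_
      have hp1 := (Nat.prime_of_mem_primeFactors hp).one_lt.ne'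
      rw [sub_eq_zero, eq_comm, inv_eq_one] at h0
      exact hp1 (by exact_mod_cast h0)
    simpa [hlog, hprod] using h4
  · refine ⟨?_, fun h1 => absurd h1 hψ⟩
    have hc : Tendsto (fun z : ℂ => -(1 - (2 : ℂ) ^ (1 - z) * ψ 2) * ψ.LFunction z * x) (𝓝[≠] 1)
        (𝓝 (-(1 - (2 : ℂ) ^ (1 - (1 : ℂ)) * ψ 2) * ψ.LFunction 1 * x)) := by
      apply Tendsto.mono_left _ nhdsWithin_le_nhds
      apply Continuous.tendsto
        (f := fun z : ℂ => -(1 - (2 : ℂ) ^ (1 - z) * ψ 2) * ψ.LFunction z * x)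
      have hL := (DirichletCharacter.differentiable_LFunction hψ).continuous
      have h2 : Continuous fun z : ℂ => (2 : ℂ) ^ (1 - z) :=
        Continuous.const_cpow (by fun_prop) (Or.inl two_ne_zero)
      fun_prop
    have h0 := tendsto_nhds_unique (hc.comp tendsto_ofReal_nhdsGT) h
    have hne := DirichletCharacter.LFunction_apply_one_ne_zero hψ
    have h5 : (1 - ψ 2) * x = 0 := by
      have : -(1 - ψ 2) * ψ.LFunction 1 * x = 0 := by simpa using h0
      have h6 : ψ.LFunction 1 * ((1 - ψ 2) * x) = 0 := by linear_combination -this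
      exact (mul_eq_zero.1 h6).resolve_left hne
    linear_combination -h5

theorem tendsto_LSeries_sieve {n : ℕ} [NeZero n] (f : ZMod n → ℂ)
    (h : ∀ k, Tendsto (fun s : ℝ => LSeries (fun m => (-1) ^ m * f (m * k)) s) (𝓝[>] 1) (𝓝 0))
    (P : Finset ℕ) (hP : ∀ p ∈ P, p.Prime ∧ Odd p) :
    ∀ k, Tendsto (fun s : ℝ =>
      LSeries (fun m => if ∀ p ∈ P, ¬ p ∣ m then (-1) ^ m * f (m * k) else 0) s)
      (𝓝[>] 1) (𝓝 0) := by
  induction P using Finset.induction_on with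
  | empty => simpa using h
  | insert p P hpP ih =>
    have ih' := ih fun q hq => hP q (Finset.mem_insert_of_mem hq)
    obtain ⟨hp, hpo⟩ := hP p (Finset.mem_insert_self p P)
    intro k
    have hb : ∀ x, ‖f x‖ ≤ ∑ y, ‖f y‖ := fun x =>
      Finset.single_le_sum (f := fun y => ‖f y‖) (fun y _ => norm_nonneg _) (Finset.mem_univ x)
    have h0 : 0 ≤ ∑ y, ‖f y‖ := Finset.sum_nonneg fun y _ => norm_nonneg _
    set g : ℕ → ℂ := fun m => if ∀ q ∈ P, ¬ q ∣ m then (-1) ^ m * f (m * k) else 0 with hg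
    have hgb : ∀ m, ‖g m‖ ≤ ∑ y, ‖f y‖ := by
      intro m
      simp only [hg]
      split_ifs
      · simpa using hb _
      · simpa using h0
    have hpt : Tendsto (fun s : ℝ => (p : ℂ) ^ (-(s : ℂ))) (𝓝[>] 1) (𝓝 ((p : ℂ) ^ (-(1 : ℂ)))) := by
      have hp0 : (p : ℂ) ≠ 0 := by exact_mod_cast hp.ne_zero
      have hc : Continuous fun s : ℝ => (p : ℂ) ^ (-(s : ℂ)) :=
        Continuous.const_cpow (by fun_prop) (Or.inl hp0)
      simpa using (hc.tendsto 1).mono_left nhdsWithin_le_nhds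
    have hlim := (ih' k).sub (hpt.mul (ih' (p * k)))
    rw [mul_zero, sub_zero] at hlim
    refine hlim.congr' ?_
    filter_upwards [self_mem_nhdsWithin] with s (hs : 1 < s)
    have hgp : (fun m : ℕ => g (p * m)) =
        fun m : ℕ => if ∀ q ∈ P, ¬ q ∣ m then (-1) ^ m * f (m * (p * k)) else 0 := by
      ext m
      have hiff : (∀ q ∈ P, ¬ q ∣ p * m) ↔ ∀ q ∈ P, ¬ q ∣ m := by
        refine forall₂_congr fun q hq => ?_
        have hq' := (hP q (Finset.mem_insert_of_mem hq)).1
        rw [hq'.dvd_mul, Nat.prime_dvd_prime_iff_eq hq' hp]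
        have : q ≠ p := fun hqp => hpP (hqp ▸ hq)
        simp [this]
      simp only [hg, hiff, pow_mul, hpo.neg_one_pow]
      push_cast
      rw [mul_assoc, mul_left_comm]
    have hsplit : (fun m : ℕ => if ∀ q ∈ insert p P, ¬ q ∣ m then (-1) ^ m * f (m * k) else 0) =
        g - fun m => if p ∣ m then g m else 0 := by
      ext m
      by_cases hpm : p ∣ m <;> simp [hg, hpm]
    rw [hsplit, LSeries_sub, LSeries_ite_dvd hp.ne_zero, hgp]
    · exact LSeriesSummable_of_bounded_of_one_lt_real (fun m _ => hgb m) hs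
    · refine LSeriesSummable_of_bounded_of_one_lt_real (m := ∑ y, ‖f y‖) (fun m _ => ?_) hs
      split_ifs
      · exact hgb m
      · simpa using h0

theorem sum_units_eq_zero_and_apply_two_mul {n : ℕ} [NeZero n] (hn : Odd n) (f : ZMod n → ℂ)
    (h : ∀ k, Tendsto (fun s : ℝ => LSeries (fun m => (-1) ^ m * f (m * k)) s) (𝓝[>] 1) (𝓝 0)) :
    (∀ k, ∑ u : (ZMod n)ˣ, f (u * k) = 0) ∧ ∀ k, f (2 * k) = f k := by
  have hP : ∀ p ∈ n.primeFactors, p.Prime ∧ Odd p := fun p hp =>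
    ⟨Nat.prime_of_mem_primeFactors hp, hn.of_dvd_nat (Nat.dvd_of_mem_primeFactors hp)⟩
  have hlim := tendsto_LSeries_sieve f h n.primeFactors hP
  have hcop : ∀ m : ℕ, (∀ p ∈ n.primeFactors, ¬ p ∣ m) ↔ IsUnit (m : ZMod n) := by
    intro m
    rw [ZMod.isUnit_iff_coprime]
    constructor
    · intro hm
      refine Nat.coprime_of_dvd fun p hp hpm hpn => ?_
      exact hm p (Nat.mem_primeFactors.2 ⟨hp, hpn, NeZero.ne n⟩) hpm
    · intro hm p hp hpm
      have := Nat.eq_one_of_dvd_coprimes hm hpm (Nat.dvd_of_mem_primeFactors hp)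
      exact (Nat.prime_of_mem_primeFactors hp).ne_one this
  simp only [hcop] at hlim
  let F : DirichletCharacter ℂ n → ZMod n → ℂ := fun ψ k =>
    ∑ u : (ZMod n)ˣ, ψ (u⁻¹ : (ZMod n)ˣ) * f (u * k)
  have hF : ∀ ψ k (v : (ZMod n)ˣ), F ψ (v * k) = ψ v * F ψ k := by
    intro ψ k v
    simp only [F, Finset.mul_sum]
    symm
    rw [← Equiv.sum_comp (Equiv.mulRight v)]
    refine Finset.sum_congr rfl fun u _ => ?_
    rw [Equiv.coe_mulRight, ← mul_assoc (ψ v), ← map_mul, mul_inv_rev, Units.val_mul,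
      Units.val_mul, Units.mul_inv_cancel_left, mul_assoc]
  have key : ∀ ψ k, ψ 2 * F ψ k = F ψ k ∧ (ψ = 1 → F ψ k = 0) := by
    intro ψ k
    apply apply_two_mul_eq_of_tendsto hn ψ
    have ht := tendsto_finsetSum (Finset.univ : Finset (ZMod n)ˣ) fun u _ =>
      (hlim (u * k)).const_mul (ψ (u⁻¹ : (ZMod n)ˣ))
    simp only [mul_zero, Finset.sum_const_zero] at ht
    refine ht.congr' ?_
    filter_upwards [self_mem_nhdsWithin] with s (hs : 1 < s)
    have hb : ∀ x, ‖f x‖ ≤ ∑ y, ‖f y‖ := fun x =>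
      Finset.single_le_sum (f := fun y => ‖f y‖) (fun y _ => norm_nonneg _) (Finset.mem_univ x)
    have h0 : 0 ≤ ∑ y, ‖f y‖ := Finset.sum_nonneg fun y _ => norm_nonneg _
    have hsum : ∑ u : (ZMod n)ˣ, ψ (u⁻¹ : (ZMod n)ˣ) * LSeries
          (fun m => if IsUnit (m : ZMod n) then (-1) ^ m * f (m * (u * k)) else 0) s =
        LSeries (∑ u : (ZMod n)ˣ, ψ (u⁻¹ : (ZMod n)ˣ) •
          fun m : ℕ => if IsUnit (m : ZMod n) then (-1) ^ m * f (m * (u * k)) else 0) s := by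
      rw [LSeries_sum]
      · simp only [LSeries_smul]
      · intro u _
        refine LSeriesSummable.smul _ (LSeriesSummable_of_bounded_of_one_lt_real
          (m := ∑ y, ‖f y‖) (fun m _ => ?_) hs)
        split_ifs
        · simpa using hb _
        · simpa using h0
    rw [hsum, mul_comm, ← LSeries_smul]
    · refine LSeries_congr (fun {m} _ => ?_) _
      by_cases hm : IsUnit (m : ZMod n)
      · obtain ⟨v, hv⟩ := hm
        simp only [Finset.sum_apply, Pi.smul_apply, smul_eq_mul, ← hv, v.isUnit, if_true]
        have := hF ψ k v
        rw [mul_comm, mul_assoc, ← this, Finset.mul_sum]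
        refine Finset.sum_congr rfl fun u _ => ?_
        rw [mul_left_comm (v : ZMod n)]
        ring
      · simp [hm, MulChar.map_nonunit]
  constructor
  · intro k
    have := (key 1 k).2 rfl
    simpa [F, MulChar.one_apply] using this
  · intro k
    have hsum : ∀ k, ∑ ψ : DirichletCharacter ℂ n, F ψ k = n.totient * f k := by
      intro k
      simp only [F]
      rw [Finset.sum_comm]
      have h1 : ∀ u : (ZMod n)ˣ, ∑ ψ : DirichletCharacter ℂ n, ψ (u⁻¹ : (ZMod n)ˣ) =
          if u = 1 then (n.totient : ℂ) else 0 := by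
        intro u
        rw [DirichletCharacter.sum_characters_eq]
        simp
      simp only [← Finset.sum_mul, h1]
      simp
    have htwo : ((ZMod.unitOfCoprime 2 (Nat.coprime_two_left.2 hn) : (ZMod n)ˣ) : ZMod n) = 2 := by
      simp
    have heq : ∀ ψ, F ψ (2 * k) = F ψ k := by
      intro ψ
      have := hF ψ k (ZMod.unitOfCoprime 2 (Nat.coprime_two_left.2 hn))
      rw [htwo] at this
      rw [this, (key ψ k).1]
    have h2 : (n.totient : ℂ) * f (2 * k) = n.totient * f k := by
      rw [← hsum, ← hsum]
      exact Finset.sum_congr rfl fun ψ _ => heq ψ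
    refine mul_left_cancel₀ ?_ h2
    exact_mod_cast (Nat.totient_pos.2 (NeZero.pos n)).ne'

theorem sum_map_FS {G : Type*} [AddCommGroup G] (χ : AddChar G ℂ) (A : Multiset G) :
    ((FS A).map χ).sum = (A.map fun a => 1 + χ a).prod := by
  induction A using Multiset.induction_on with
  | empty => simp [FS]
  | cons a A ih =>
    rw [Multiset.map_cons, Multiset.prod_cons, ← ih]
    simp [FS, AddChar.map_add_eq_mul, Multiset.sum_map_mul_left, add_mul]

theorem tendsto_LSeries_sum_pow {G : Type*} (X : Multiset G) (w : G → ℂ)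
    (hw : ∀ a, ‖w a‖ = 1 ∧ w a ≠ 1) :
    Tendsto (fun s : ℝ => LSeries (fun m => (X.map fun a => w a ^ m).sum) s) (𝓝[>] 1)
      (𝓝 (X.map fun a => -Complex.log (1 - w a)).sum) := by
  induction X using Multiset.induction_on with
  | empty =>
    have h0 : ∀ s : ℂ, LSeries (fun _ => 0) s = 0 := congrFun LSeries_zero
    simp [h0]
  | cons a X ih =>
    rw [Multiset.map_cons, Multiset.sum_cons]
    refine ((tendsto_LSeries_pow (hw a).1 (hw a).2).add ih).congr' ?_
    filter_upwards [self_mem_nhdsWithin] with s (hs : 1 < s)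
    rw [← LSeries_add]
    · congr 1
      ext m
      simp
    · exact LSeriesSummable_of_bounded_of_one_lt_real (m := 1) (fun m _ => by simp [(hw a).1]) hs
    · refine LSeriesSummable_of_bounded_of_one_lt_real (m := X.card) (fun m _ => ?_) hs
      refine (norm_multiset_sum_le _).trans ?_
      simp [(hw _).1]

theorem log_one_add_add_log_one_add_inv {z : ℂ} (hz : ‖z‖ = 1) :
    Complex.log (1 + z) + Complex.log (1 + z⁻¹) = (2 * Real.log ‖1 + z‖ : ℝ) := by
  have harg : (1 + z).arg ≠ Real.pi := by
    rw [Ne, Complex.arg_eq_pi_iff]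
    rintro ⟨hre, him⟩
    have h1 := Complex.abs_re_le_norm z
    rw [hz, abs_le] at h1
    simp only [Complex.add_re, Complex.one_re] at hre
    linarith
  have hconj : 1 + z⁻¹ = (starRingEnd ℂ) (1 + z) := by
    rw [Complex.inv_eq_conj hz, map_add, map_one]
  rw [hconj, Complex.log_conj _ harg, Complex.add_conj, Complex.log_re]

theorem one_add_ne_zero_of_pow_eq_one {n : ℕ} (hn : Odd n) {z : ℂ} (hz : z ^ n = 1) :
    z ≠ -1 := by
  rintro rfl
  rw [hn.neg_one_pow] at hz
  norm_num at hz

theorem sum_log_add_neg {G : Type*} [AddCommGroup G] {n : ℕ} (hn : Odd n)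
    (χ : AddChar G ℂ) (hχ : ∀ a, χ a ^ n = 1) (A : Multiset G) :
    ((A + A.map Neg.neg).map fun a => Complex.log (1 + χ a)).sum =
      (2 * Real.log ‖(A.map fun a => 1 + χ a).prod‖ : ℝ) := by
  have hn0 : n ≠ 0 := by rintro rfl; simp at hn
  have h1 : ∀ a, 1 + χ a ≠ 0 := fun a h0 =>
    one_add_ne_zero_of_pow_eq_one hn (hχ a) (by linear_combination h0)
  induction A using Multiset.induction_on with
  | empty => simp
  | cons a A ih =>
    have h2 : (A.map fun a => 1 + χ a).prod ≠ 0 := by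
      refine Multiset.prod_ne_zero ?_
      simp [h1]
    have h3 := log_one_add_add_log_one_add_inv (Complex.norm_eq_one_of_pow_eq_one (hχ a) hn0)
    rw [Multiset.map_add, Multiset.sum_add, Multiset.map_map] at ih
    rw [Multiset.map_add, Multiset.sum_add, Multiset.map_map, Multiset.map_cons,
      Multiset.map_cons, Multiset.map_cons, Multiset.sum_cons, Multiset.sum_cons,
      Multiset.prod_cons, norm_mul, Real.log_mul (norm_ne_zero_iff.2 (h1 a))
        (norm_ne_zero_iff.2 h2), Function.comp, AddChar.map_neg_eq_inv, add_add_add_comm, h3]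
    erw [ih]
    push_cast
    ring

theorem sum_pow_of_FS_eq {G : Type*} [AddCommGroup G] {n : ℕ} [NeZero n] (hn : Odd n)
    (χ : AddChar G ℂ) (hχ : ∀ a, χ a ^ n = 1) {A B : Multiset G} (h : FS A = FS B) :
    (∑ u : (ZMod n)ˣ, ((A + A.map Neg.neg).map fun a => χ a ^ (u : ZMod n).val).sum =
      ∑ u : (ZMod n)ˣ, ((B + B.map Neg.neg).map fun a => χ a ^ (u : ZMod n).val).sum) ∧
    ((A + A.map Neg.neg).map fun a => χ a ^ 2).sum + ((B + B.map Neg.neg).map χ).sum =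
      ((A + A.map Neg.neg).map χ).sum + ((B + B.map Neg.neg).map fun a => χ a ^ 2).sum := by
  set X := A + A.map Neg.neg with hX
  set Y := B + B.map Neg.neg with hY
  let f : ZMod n → ℂ := fun k =>
    (X.map fun a => χ a ^ k.val).sum - (Y.map fun a => χ a ^ k.val).sum
  have hval : ∀ (j : ℕ) (a : G), χ a ^ ((j : ZMod n)).val = χ a ^ j := by
    intro j a
    rw [ZMod.val_natCast]
    exact (pow_eq_pow_mod j (hχ a)).symm
  have hlim : ∀ k, Tendsto (fun s : ℝ => LSeries (fun m => (-1) ^ m * f (m * k)) s)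
      (𝓝[>] 1) (𝓝 0) := by
    intro k
    have hk : ∀ a, (χ ^ k.val) a ^ n = 1 := fun a => by
      rw [AddChar.pow_apply, pow_right_comm, hχ, one_pow]
    have hw : ∀ a, ‖-(χ ^ k.val) a‖ = 1 ∧ -(χ ^ k.val) a ≠ 1 := by
      intro a
      rw [norm_neg]
      refine ⟨Complex.norm_eq_one_of_pow_eq_one (hk a) (NeZero.ne n), fun h0 => ?_⟩
      exact one_add_ne_zero_of_pow_eq_one hn (hk a) (by linear_combination -h0)
    have hlA := tendsto_LSeries_sum_pow X _ hw
    have hlB := tendsto_LSeries_sum_pow Y _ hw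
    have hzero : (X.map fun a => -Complex.log (1 - -(χ ^ k.val) a)).sum -
        (Y.map fun a => -Complex.log (1 - -(χ ^ k.val) a)).sum = 0 := by
      simp only [sub_neg_eq_add, Multiset.sum_map_neg]
      rw [hX, hY, sum_log_add_neg hn _ hk, sum_log_add_neg hn _ hk, ← sum_map_FS, ← sum_map_FS, h,
        neg_add_cancel]
    have hl := hlA.sub hlB
    rw [hzero] at hl
    refine hl.congr' ?_
    filter_upwards [self_mem_nhdsWithin] with s (hs : 1 < s)
    rw [← LSeries_sub]
    · congr 1
      ext m
      have hmk : ∀ a, χ a ^ ((m : ZMod n) * k).val = (χ a ^ k.val) ^ m := by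
        intro a
        rw [← pow_mul, ← hval (k.val * m)]
        congr 2
        push_cast
        rw [ZMod.natCast_zmod_val, mul_comm]
      simp only [f, hmk, Pi.sub_apply, AddChar.pow_apply, mul_sub, ← Multiset.sum_map_mul_left,
        ← mul_pow, neg_one_mul]
    · refine LSeriesSummable_of_bounded_of_one_lt_real (m := X.card) (fun m _ => ?_) hs
      refine (norm_multiset_sum_le _).trans ?_
      simp only [Multiset.map_map, Function.comp, norm_pow, (hw _).1, one_pow]
      simp
    · refine LSeriesSummable_of_bounded_of_one_lt_real (m := Y.card) (fun m _ => ?_) hs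
      refine (norm_multiset_sum_le _).trans ?_
      simp only [Multiset.map_map, Function.comp, norm_pow, (hw _).1, one_pow]
      simp
  obtain ⟨h1, h2⟩ := sum_units_eq_zero_and_apply_two_mul hn f hlim
  constructor
  · have := h1 1
    simpa [f, sub_eq_zero] using this
  · have h3 := h2 1
    have e1 : ∀ a, χ a ^ (1 : ZMod n).val = χ a := fun a => by simpa using hval 1 a
    have e2 : ∀ a, χ a ^ (2 : ZMod n).val = χ a ^ 2 := fun a => by simpa using hval 2 a
    simp only [f, mul_one, e1, e2] at h3
    linear_combination h3

theorem sum_addChar_mul_sum {Q : Type*} [AddCommGroup Q] [Fintype Q] [DecidableEq Q]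
    (X : Multiset Q) (g : Q) :
    ∑ ψ : AddChar Q ℂ, ψ (-g) * (X.map ψ).sum = Fintype.card Q * X.count g := by
  induction X using Multiset.induction_on with
  | empty => simp
  | cons a X ih =>
    simp only [Multiset.map_cons, Multiset.sum_cons, mul_add, Finset.sum_add_distrib, ih,
      ← AddChar.map_add_eq_mul, AddChar.sum_apply_eq_ite, Multiset.count_cons]
    by_cases hg : g = a
    · subst hg
      simp
      ring
    · rw [if_neg hg, if_neg]
      · simp
      · intro h0
        exact hg (by rwa [neg_add_eq_zero] at h0)

theorem eq_of_sum_addChar_eq {Q : Type*} [AddCommGroup Q] [Fintype Q] {X Y : Multiset Q}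
    (h : ∀ ψ : AddChar Q ℂ, (X.map ψ).sum = (Y.map ψ).sum) : X = Y := by
  classical
  ext g
  have h1 := sum_addChar_mul_sum X g
  simp only [h] at h1
  rw [sum_addChar_mul_sum] at h1
  have : (Fintype.card Q : ℂ) ≠ 0 := by exact_mod_cast Fintype.card_ne_zero
  exact_mod_cast (mul_left_cancel₀ this h1).symm

theorem addChar_pow_card {Q : Type*} [AddCommGroup Q] [Fintype Q] (ψ : AddChar Q ℂ) (a : Q) :
    ψ a ^ Fintype.card Q = 1 := by
  rw [← AddChar.map_nsmul_eq_pow, card_nsmul_eq_zero, AddChar.map_zero_eq_one]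

theorem map_double_add_eq_of_FS_eq_of_finite {Q : Type*} [AddCommGroup Q] [Fintype Q]
    (hQ : Odd (Fintype.card Q)) {A B : Multiset Q} (h : FS A = FS B) :
    (A + A.map Neg.neg).map (fun a => a + a) + (B + B.map Neg.neg) =
      (A + A.map Neg.neg) + (B + B.map Neg.neg).map (fun a => a + a) := by
  refine eq_of_sum_addChar_eq fun ψ => ?_
  have := (sum_pow_of_FS_eq hQ ψ (addChar_pow_card ψ) h).2
  have e : ∀ X : Multiset Q,
      ((X.map fun a => a + a).map ψ).sum = (X.map fun a => ψ a ^ 2).sum := by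
    intro X
    simp only [Multiset.map_map, Function.comp, AddChar.map_add_eq_mul, sq]
  generalize A + A.map Neg.neg = X at *
  generalize B + B.map Neg.neg = Y at *
  rw [Multiset.map_add, Multiset.sum_add, e, this, Multiset.map_add ψ, Multiset.sum_add, e]

theorem count_zero_eq_of_FS_eq_of_finite {Q : Type*} [AddCommGroup Q] [Fintype Q] [DecidableEq Q]
    (hQ : Odd (Fintype.card Q)) {A B : Multiset Q} (h : FS A = FS B) :
    A.count 0 = B.count 0 := by
  set n := Fintype.card Q with hn
  have hsum : ∀ (A : Multiset Q),
      ∑ ψ : AddChar Q ℂ, ∑ u : (ZMod n)ˣ,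
        ((A + A.map Neg.neg).map fun a => ψ a ^ (u : ZMod n).val).sum =
      n.totient * (n * (2 * A.count 0)) := by
    intro A
    rw [Finset.sum_comm]
    have hu : ∀ u : (ZMod n)ˣ, ∑ ψ : AddChar Q ℂ,
        ((A + A.map Neg.neg).map fun a => ψ a ^ (u : ZMod n).val).sum = n * (2 * A.count 0) := by
      intro u
      have hcop : (Nat.card (AddChar Q ℂ)).Coprime (u : ZMod n).val := by
        rw [Nat.card_eq_fintype_card, AddChar.card_eq]
        exact (ZMod.val_coe_unit_coprime u).symm
      have h1 := (powCoprime hcop).sum_comp fun ψ : AddChar Q ℂ =>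
        ((A + A.map Neg.neg).map ψ).sum
      have h2 := sum_addChar_mul_sum (A + A.map Neg.neg) 0
      have hneg : (A.map Neg.neg).count 0 = A.count 0 := by
        have := Multiset.count_map_eq_count' (Neg.neg : Q → Q) A neg_injective 0
        rwa [neg_zero] at this
      simp only [neg_zero, AddChar.map_zero_eq_one, one_mul, Multiset.count_add, hneg] at h2
      rw [h2] at h1
      simp only [powCoprime_apply, AddChar.coe_pow] at h1
      rw [← hn] at h1
      push_cast at h1
      rw [two_mul, ← h1]
      rfl
    rw [Finset.sum_congr rfl fun u _ => hu u]
    simp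
  have h1 := hsum A
  rw [Finset.sum_congr rfl fun ψ _ => (sum_pow_of_FS_eq hQ ψ (addChar_pow_card ψ) h).1,
    hsum B] at h1
  have hn0 : n ≠ 0 := Fintype.card_ne_zero
  have ht : n.totient ≠ 0 := (Nat.totient_pos.2 (Nat.pos_of_ne_zero hn0)).ne'
  have h2 : n.totient * (n * (2 * B.count 0)) = n.totient * (n * (2 * A.count 0)) := by
    exact_mod_cast h1
  have h3 := Nat.eq_of_mul_eq_mul_left (Nat.pos_of_ne_zero hn0)
    (Nat.eq_of_mul_eq_mul_left (Nat.pos_of_ne_zero ht) h2)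
  omega

theorem eq_zero_of_two_pow_nsmul {G : Type*} [AddCommGroup G] (h2 : ∀ g : G, g + g = 0 → g = 0)
    {k : ℕ} {g : G} (h : 2 ^ k • g = 0) : g = 0 := by
  induction k with
  | zero => simpa using h
  | succ k ih =>
    refine ih (h2 _ ?_)
    rwa [← two_nsmul, ← mul_nsmul, ← pow_succ]

theorem double_injective {G : Type*} [AddCommGroup G] (h2 : ∀ g : G, g + g = 0 → g = 0) :
    Function.Injective fun g : G => g + g := by
  intro a b (h : a + a = b + b)
  refine sub_eq_zero.1 (h2 _ ?_)
  rw [sub_add_sub_comm, h, sub_self]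

theorem exists_addMonoidHom_zmod_odd {K : Type*} [AddCommGroup K] [AddGroup.FG K]
    (h2 : ∀ g : K, g + g = 0 → g = 0) {d : K} (hd : d ≠ 0) :
    ∃ n, Odd n ∧ ∃ f : K →+ ZMod n, f d ≠ 0 := by
  classical
  obtain ⟨r, ι, _, p, hp, e, ⟨F⟩⟩ := AddCommGroup.equiv_free_prod_directSum_zmod K
  by_cases h : ∃ i, (F d).1 i ≠ 0
  · obtain ⟨i, hi⟩ := h
    set x := (F d).1 i with hx
    refine ⟨2 * x.natAbs + 1, ⟨_, rfl⟩, (Int.castAddHom _).comp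
      ((Finsupp.applyAddHom i).comp ((AddMonoidHom.fst _ _).comp F.toAddMonoidHom)), ?_⟩
    change ((Int.cast x) : ZMod (2 * x.natAbs + 1)) ≠ 0
    rw [Ne, ZMod.intCast_zmod_eq_zero_iff_dvd]
    intro hdvd
    have := Nat.le_of_dvd (Int.natAbs_pos.2 hi) (Int.natCast_dvd.1 hdvd)
    omega
  · push Not at h
    have h1 : (F d).1 = 0 := Finsupp.ext h
    have h3 : (F d).2 ≠ 0 := fun h0 => hd (F.map_eq_zero_iff.1 (Prod.ext h1 h0))
    obtain ⟨i, hi⟩ : ∃ i, (F d).2 i ≠ 0 := by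
      by_contra! hcon
      exact h3 (DFinsupp.ext hcon)
    refine ⟨p i ^ e i, Odd.pow ((hp i).odd_of_ne_two fun hpi => hi ?_),
      (DFinsupp.evalAddMonoidHom i).comp ((AddMonoidHom.snd _ _).comp F.toAddMonoidHom), hi⟩
    have h4 : F.symm (0, DirectSum.of (fun i => ZMod (p i ^ e i)) i ((F d).2 i)) = 0 := by
      refine eq_zero_of_two_pow_nsmul h2 (k := e i) ?_
      rw [← map_nsmul, Prod.smul_mk, ← map_nsmul, ← hpi, nsmul_eq_mul, ZMod.natCast_self]
      simp
    have h5 := congrArg Prod.snd (F.symm.map_eq_zero_iff.1 h4)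
    have h6 : DirectSum.of (fun i => ZMod (p i ^ e i)) i ((F d).2 i) = 0 := h5
    exact DirectSum.of_injective i (h6.trans (map_zero _).symm)

universe u

theorem exists_odd_finite_quotient_injOn {G : Type u} [AddCommGroup G]
    (h2 : ∀ g : G, g + g = 0 → g = 0) (S : Finset G) :
    ∃ (K : AddSubgroup G) (Q : Type u) (_ : AddCommGroup Q) (_ : Fintype Q) (φ : K →+ Q),
      Odd (Fintype.card Q) ∧ (∀ g ∈ S, g ∈ K) ∧
        ∀ x y : K, (x : G) ∈ S → (y : G) ∈ S → φ x = φ y → x = y := by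
  classical
  set K := AddSubgroup.closure (S : Set G) with hK
  have hSK : ∀ g ∈ S, g ∈ K := fun g hg => AddSubgroup.subset_closure hg
  have : AddGroup.FG K := (AddGroup.fg_iff_addSubgroup_fg K).2 ⟨S, rfl⟩
  have h2K : ∀ g : K, g + g = 0 → g = 0 := fun g hg =>
    Subtype.ext (h2 _ (congrArg Subtype.val hg))
  have hsep : ∀ q : S × S, ∃ n, Odd n ∧ ∃ f : K →+ ZMod n, q.1 ≠ q.2 →
      f (⟨q.1, hSK _ q.1.2⟩ - ⟨q.2, hSK _ q.2.2⟩) ≠ 0 := by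
    intro q
    by_cases hq : q.1 = q.2
    · exact ⟨1, odd_one, 0, fun h => (h hq).elim⟩
    · have hne : (⟨q.1, hSK _ q.1.2⟩ - ⟨q.2, hSK _ q.2.2⟩ : K) ≠ 0 := by
        rw [sub_ne_zero]
        exact fun h => hq (Subtype.ext (Subtype.mk.inj h))
      obtain ⟨n, hn, f, hf⟩ := exists_addMonoidHom_zmod_odd h2K hne
      exact ⟨n, hn, f, fun _ => hf⟩
  choose n hn f hf using hsep
  have : ∀ q, NeZero (n q) := fun q => ⟨by rintro h; simpa [h] using hn q⟩
  refine ⟨K, ∀ q, ZMod (n q), inferInstance, inferInstance, AddMonoidHom.pi f, ?_, hSK, ?_⟩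
  · rw [Fintype.card_pi]
    simp only [ZMod.card]
    exact Finset.prod_induction _ Odd (fun _ _ => Odd.mul) odd_one fun q _ => hn q
  · intro x y hx hy hxy
    by_contra hne
    refine hf (⟨x, hx⟩, ⟨y, hy⟩) (fun h => hne (Subtype.ext (Subtype.mk.inj h))) ?_
    have := congrFun hxy (⟨x, hx⟩, ⟨y, hy⟩)
    rw [map_sub, sub_eq_zero]
    exact this

theorem sum_map_addMonoidHom {M N : Type*} [AddCommMonoid M] [AddCommMonoid N] (φ : M →+ N)
    (A : Multiset M) : (A.map φ).sum = φ A.sum := (map_multiset_sum φ A).symm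

theorem FS_map {M N : Type*} [AddCommMonoid M] [AddCommMonoid N] (φ : M →+ N)
    (A : Multiset M) : FS (A.map φ) = (FS A).map φ := by
  induction A using Multiset.induction_on with
  | empty => simp [FS]
  | cons a A ih =>
    have h := congrArg (Multiset.map fun x => φ a + x) ih
    simp only [FS, Multiset.map_map, Function.comp_def] at ih h ⊢
    simp [ih, h]

theorem Multiset.eq_of_map_eq_of_injOn {α β : Type*} {f : α → β} {X Y : Multiset α}
    (hf : ∀ x y, x ∈ X + Y → y ∈ X + Y → f x = f y → x = y) (h : X.map f = Y.map f) : X = Y := by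
  by_cases hα : Nonempty α
  · have key : ∀ Z : Multiset α, (∀ x ∈ Z, x ∈ X + Y) →
        (Z.map f).map (Function.invFunOn f {x | x ∈ X + Y}) = Z := by
      intro Z hZ
      rw [Multiset.map_map]
      conv_rhs => rw [← Multiset.map_id Z]
      refine Multiset.map_congr rfl fun x hx => ?_
      have hx' : ∃ a ∈ {x | x ∈ X + Y}, f a = f x := ⟨x, hZ x hx, rfl⟩
      exact hf _ _ (Function.invFunOn_mem hx') (hZ x hx) (Function.invFunOn_eq hx')
    rw [← key X fun x hx => Multiset.mem_add.2 (.inl hx), h,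
      key Y fun x hx => Multiset.mem_add.2 (.inr hx)]
  · rw [not_nonempty_iff] at hα
    rw [Multiset.eq_zero_of_forall_notMem (s := X) fun a => isEmptyElim a,
      Multiset.eq_zero_of_forall_notMem (s := Y) fun a => isEmptyElim a]

theorem exists_eq_map_val {G : Type*} [AddCommGroup G] (K : AddSubgroup G) (A : Multiset G)
    (h : ∀ a ∈ A, a ∈ K) : ∃ A' : Multiset K, A = A'.map K.subtype := by
  refine ⟨A.attach.map fun a => ⟨a.1, h _ a.2⟩, ?_⟩
  rw [Multiset.map_map]
  simp [Function.comp_def]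

theorem map_double_add_eq_of_FS_eq {G : Type*} [AddCommGroup G]
    (h2 : ∀ g : G, g + g = 0 → g = 0) {A B : Multiset G} (h : FS A = FS B) :
    (A + A.map Neg.neg).map (fun a => a + a) + (B + B.map Neg.neg) =
      (A + A.map Neg.neg) + (B + B.map Neg.neg).map (fun a => a + a) := by
  classical
  obtain ⟨K, Q, _, _, φ, hQ, hK, hφ⟩ := exists_odd_finite_quotient_injOn h2
    ((A + A.map Neg.neg).map (fun a => a + a) + (B + B.map Neg.neg) +
      ((A + A.map Neg.neg) + (B + B.map Neg.neg).map (fun a => a + a))).toFinset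
  obtain ⟨A, rfl⟩ := exists_eq_map_val K A fun a ha => hK a (by simp [ha])
  obtain ⟨B, rfl⟩ := exists_eq_map_val K B fun a ha => hK a (by simp [ha])
  have hFS : FS A = FS B := by
    rw [FS_map, FS_map] at h
    exact Multiset.map_injective Subtype.val_injective h
  have hQ := map_double_add_eq_of_FS_eq_of_finite hQ (A := A.map φ) (B := B.map φ)
    (by rw [FS_map, FS_map, hFS])
  have e : ∀ {M : Type _} [AddCommGroup M] (ψ : K →+ M) (A B : Multiset K),
      (A.map ψ + (A.map ψ).map Neg.neg).map (fun a => a + a) + (B.map ψ + (B.map ψ).map Neg.neg)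
      = ((A + A.map Neg.neg).map (fun a => a + a) + (B + B.map Neg.neg)).map ψ := by
    intro M _ ψ A B
    simp [Multiset.map_map]
  rw [add_comm (_ + _) (Multiset.map _ _), e, e] at hQ ⊢
  simp only [add_comm (_ + _) (Multiset.map _ _), e] at hφ
  congr 1
  refine Multiset.eq_of_map_eq_of_injOn (fun x y hx hy => hφ x y ?_ ?_) hQ
  · rw [← Multiset.map_add, Multiset.mem_toFinset]
    exact Multiset.mem_map_of_mem _ hx
  · rw [← Multiset.map_add, Multiset.mem_toFinset]
    exact Multiset.mem_map_of_mem _ hy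

theorem count_zero_eq_of_FS_eq {G : Type*} [AddCommGroup G] [DecidableEq G]
    (h2 : ∀ g : G, g + g = 0 → g = 0) {A B : Multiset G} (h : FS A = FS B) :
    A.count 0 = B.count 0 := by
  classical
  obtain ⟨K, Q, _, _, φ, hQ, hK, hφ⟩ := exists_odd_finite_quotient_injOn h2
    (0 ::ₘ (A + B)).toFinset
  obtain ⟨A, rfl⟩ := exists_eq_map_val K A fun a ha => hK a (by simp [ha])
  obtain ⟨B, rfl⟩ := exists_eq_map_val K B fun a ha => hK a (by simp [ha])
  have hFS : FS A = FS B := by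
    rw [FS_map, FS_map] at h
    exact Multiset.map_injective Subtype.val_injective h
  have hQ := count_zero_eq_of_FS_eq_of_finite hQ (A := A.map φ) (B := B.map φ)
    (by rw [FS_map, FS_map, hFS])
  have e : ∀ X : Multiset K, X ≤ A + B → (X.map K.subtype).count 0 = (X.map φ).count 0 := by
    intro X hX
    rw [Multiset.count_map, Multiset.count_map]
    congr 1
    refine Multiset.filter_congr fun x hx => ⟨fun h0 => ?_, fun h0 => ?_⟩
    · obtain rfl : x = 0 := Subtype.ext h0.symm
      exact (map_zero φ).symm
    · rw [hφ x 0 ?_ (by simp) (by rw [← h0, map_zero]), map_zero]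
      rw [Multiset.mem_toFinset, ← Multiset.map_add]
      exact Multiset.mem_cons_of_mem (Multiset.mem_map_of_mem _ (Multiset.mem_of_le hX hx))
  rw [e A (Multiset.le_add_right _ _), e B (Multiset.le_add_left _ _), hQ]

theorem finsum_count_sub_count_smul {G M : Type*} [DecidableEq G] [AddCommGroup M]
    (A B : Multiset G) (v : G → M) :
    ∑ᶠ g, ((A.count g : ℤ) - (B.count g : ℤ)) • v g = (A.map v).sum - (B.map v).sum := by
  have key : ∀ X : Multiset G, X ≤ A + B →
      ∑ g ∈ (A + B).toFinset, (X.count g : ℤ) • v g = (X.map v).sum := by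
    intro X hX
    rw [Finset.sum_multiset_map_count]
    simp only [natCast_zsmul]
    refine (Finset.sum_subset (Multiset.toFinset_subset.2 (Multiset.subset_of_le hX)) ?_).symm
    intro g _ hg
    rw [Multiset.mem_toFinset] at hg
    rw [Multiset.count_eq_zero_of_notMem hg, zero_nsmul]
  rw [finsum_eq_sum_of_support_subset (s := (A + B).toFinset), ← key A (Multiset.le_add_right _ _),
    ← key B (Multiset.le_add_left _ _), ← Finset.sum_sub_distrib]
  · simp only [sub_smul]
  · intro g hg
    by_contra hcon
    simp only [Finset.mem_coe, Multiset.mem_toFinset, Multiset.mem_add, not_or] at hcon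
    simp [Multiset.count_eq_zero_of_notMem hcon.1, Multiset.count_eq_zero_of_notMem hcon.2] at hg

theorem finsum_mem_count_sub_count {G : Type*} [DecidableEq G] (A B : Multiset G) (s : Set G)
    [DecidablePred (· ∈ s)] :
    ∑ᶠ g ∈ s, ((A.count g : ℤ) - (B.count g : ℤ)) = (A.countP (· ∈ s) : ℤ) - B.countP (· ∈ s) := by
  have h := finsum_count_sub_count_smul A B fun g => if g ∈ s then (1 : ℤ) else 0
  have e : ∀ X : Multiset G, (X.map fun g => if g ∈ s then (1 : ℤ) else 0).sum =
      X.countP (· ∈ s) := by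
    intro X
    induction X using Multiset.induction_on with
    | empty => simp
    | cons a X ih => by_cases ha : a ∈ s <;> simp [ha, ih, add_comm]
  rw [e, e] at h
  rw [← h]
  refine finsum_congr fun g => ?_
  by_cases hg : g ∈ s <;> simp [hg]

theorem count_map_neg {G : Type*} [AddCommGroup G] [DecidableEq G] (A : Multiset G) (g : G) :
    (A.map Neg.neg).count g = A.count (-g) := by
  have := Multiset.count_map_eq_count' (Neg.neg : G → G) A neg_injective (-g)
  rwa [neg_neg] at this

theorem map_eq_self_of_forall_count_eq {G : Type*} [DecidableEq G] {f : G → G}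
    (hf : Function.Injective f) {C : Multiset G} (h : ∀ g, C.count g = C.count (f g)) :
    C.map f = C := by
  refine Multiset.eq_of_le_of_card_le (Multiset.le_iff_count.2 fun g => ?_) (by simp)
  by_cases hg : ∃ x, f x = g
  · obtain ⟨x, rfl⟩ := hg
    rw [Multiset.count_map_eq_count' f _ hf, h]
  · rw [Multiset.count_eq_zero_of_notMem]
    · exact Nat.zero_le _
    · intro hmem
      obtain ⟨x, -, hx⟩ := Multiset.mem_map.1 hmem
      exact hg ⟨x, hx⟩

theorem sub_add_eq_sub_add {G : Type*} [DecidableEq G] (X Y : Multiset G) :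
    X - Y + Y = Y - X + X := by
  ext g
  simp only [Multiset.count_add, Multiset.count_sub]
  omega

theorem map_sub_eq_of_forall_count {G : Type*} [DecidableEq G] {f : G → G}
    (hf : Function.Injective f) {X Y : Multiset G}
    (h : ∀ g, X.count g + Y.count (f g) = X.count (f g) + Y.count g) :
    (X - Y).map f = X - Y := by
  refine map_eq_self_of_forall_count_eq hf fun g => ?_
  have := h g
  simp only [Multiset.count_sub]
  omega

theorem map_add_eq_iff_forall_count {G : Type*} [DecidableEq G] {f : G → G}
    (hf : Function.Injective f) (X Y : Multiset G) :
    X.map f + Y = X + Y.map f ↔ ∀ g, X.count g + Y.count (f g) = X.count (f g) + Y.count g := by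
  constructor
  · intro h g
    have := congrArg (Multiset.count (f g)) h
    simpa only [Multiset.count_add, Multiset.count_map_eq_count' f _ hf] using this
  · intro h
    have h1 := map_sub_eq_of_forall_count hf h
    have h2 := map_sub_eq_of_forall_count (X := Y) (Y := X) hf fun g => by have := h g; omega
    have h3 := congrArg (Multiset.map f) (sub_add_eq_sub_add X Y)
    rw [Multiset.map_add, Multiset.map_add, h1, h2] at h3
    have h4 := sub_add_eq_sub_add X Y
    generalize X - Y = C at *
    generalize Y - X = D at *
    refine add_left_cancel (a := C + D) ?_
    rw [add_comm (X.map f), add_add_add_comm, h4, ← h3, add_comm X, add_add_add_comm C D, add_comm]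

theorem memV_count_sub_count_iff {G : Type*} [AddCommGroup G] [DecidableEq G]
    (h2 : ∀ g : G, g + g = 0 → g = 0) (A B : Multiset G) :
    memV (fun g => (A.count g : ℤ) - (B.count g : ℤ)) ↔
      (A + A.map Neg.neg).map (fun a => a + a) + (B + B.map Neg.neg) =
        (A + A.map Neg.neg) + (B + B.map Neg.neg).map (fun a => a + a) ∧
      ∀ (H : AddSubgroup G) [DecidablePred (· ∈ H)], A.countP (· ∈ H) = B.countP (· ∈ H) := by
  rw [map_add_eq_iff_forall_count (double_injective h2), memV]
  have hfin : (Function.support fun g => (A.count g : ℤ) - (B.count g : ℤ)).Finite := by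
    refine (A + B).toFinset.finite_toSet.subset fun g hg => ?_
    by_contra hcon
    simp only [Finset.mem_coe, Multiset.mem_toFinset, Multiset.mem_add, not_or] at hcon
    simp [Multiset.count_eq_zero_of_notMem hcon.1, Multiset.count_eq_zero_of_notMem hcon.2] at hg
  refine ⟨fun ⟨_, h1, h2⟩ => ⟨fun g => ?_, fun H _ => ?_⟩, fun ⟨h1, h2⟩ => ⟨hfin, fun g => ?_,
    fun H => ?_⟩⟩
  · have := h1 g
    simp only [Multiset.count_add, count_map_neg]
    omega
  · have := h2 H
    rw [finsum_mem_count_sub_count A B (H : Set G)] at this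
    exact_mod_cast sub_eq_zero.1 this
  · have := h1 g
    simp only [Multiset.count_add, count_map_neg] at this ⊢
    omega
  · classical
    rw [finsum_mem_count_sub_count A B (H : Set G)]
    exact sub_eq_zero.2 (by exact_mod_cast h2 H)

theorem card_FS {G : Type*} [AddCommMonoid G] (A : Multiset G) : (FS A).card = 2 ^ A.card := by
  simp [FS]

theorem card_eq_of_FS_eq {G : Type*} [AddCommMonoid G] {A B : Multiset G} (h : FS A = FS B) :
    A.card = B.card := by
  have := congrArg Multiset.card h
  rw [card_FS, card_FS] at this
  exact Nat.pow_right_injective le_rfl this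

theorem two_nsmul_sum_FS {G : Type*} [AddCommMonoid G] (A : Multiset G) :
    2 • (FS A).sum = 2 ^ A.card • A.sum := by
  induction A using Multiset.induction_on with
  | empty => simp [FS]
  | cons a A ih =>
    have e : FS (a ::ₘ A) = FS A + (FS A).map fun x => a + x := by
      simp [FS, Multiset.map_map]
    rw [e, Multiset.sum_add, Multiset.sum_map_add, Multiset.map_id', Multiset.map_const',
      Multiset.sum_replicate, card_FS, nsmul_add, nsmul_add, ih, Multiset.card_cons,
      Multiset.sum_cons, pow_succ, mul_nsmul', ← mul_nsmul', mul_comm 2, mul_nsmul']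
    simp only [nsmul_add, two_nsmul]
    abel

theorem sum_eq_of_FS_eq {G : Type*} [AddCommGroup G]
    (h2 : ∀ g : G, g + g = 0 → g = 0) {A B : Multiset G} (h : FS A = FS B) :
    A.sum = B.sum := by
  have h1 := two_nsmul_sum_FS A
  rw [h, two_nsmul_sum_FS, card_eq_of_FS_eq h] at h1
  refine sub_eq_zero.1 (eq_zero_of_two_pow_nsmul h2 (k := B.card) ?_)
  rw [nsmul_sub, h1, sub_self]

/-- The elements some `2 ^ k`-th multiple of which lies in `H`. -/
def AddSubgroup.twoSaturation {G : Type*} [AddCommGroup G] (H : AddSubgroup G) :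
    AddSubgroup G where
  carrier := {g | ∃ k : ℕ, 2 ^ k • g ∈ H}
  zero_mem' := ⟨0, by simp⟩
  add_mem' := by
    rintro a b ⟨k, hk⟩ ⟨l, hl⟩
    refine ⟨k + l, ?_⟩
    rw [nsmul_add]
    refine H.add_mem ?_ ?_
    · rw [pow_add, mul_nsmul]
      exact H.nsmul_mem hk _
    · rw [pow_add, mul_nsmul']
      exact H.nsmul_mem hl _
  neg_mem' := by
    rintro a ⟨k, hk⟩
    exact ⟨k, by simpa using hk⟩

theorem quotient_twoSaturation_eq_zero {G : Type*} [AddCommGroup G] (H : AddSubgroup G)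
    (x : G ⧸ H.twoSaturation) (hx : x + x = 0) : x = 0 := by
  induction x using QuotientAddGroup.induction_on with
  | H g =>
    rw [← QuotientAddGroup.mk_add, QuotientAddGroup.eq_zero_iff] at hx
    rw [QuotientAddGroup.eq_zero_iff]
    obtain ⟨k, hk⟩ := hx
    exact ⟨k + 1, by rwa [pow_succ', mul_nsmul, two_nsmul]⟩

theorem countP_twoSaturation_eq_of_FS_eq {G : Type*} [AddCommGroup G] {A B : Multiset G}
    (h : FS A = FS B) (H : AddSubgroup G) [DecidablePred (· ∈ H.twoSaturation)] :
    A.countP (· ∈ H.twoSaturation) = B.countP (· ∈ H.twoSaturation) := by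
  classical
  let π := QuotientAddGroup.mk' H.twoSaturation
  have h1 := count_zero_eq_of_FS_eq (quotient_twoSaturation_eq_zero H) (A := A.map π)
    (B := B.map π) (by rw [FS_map, FS_map, h])
  have e : ∀ X : Multiset G, (X.map π).count 0 = X.countP (· ∈ H.twoSaturation) := by
    intro X
    rw [Multiset.count_map, Multiset.countP_eq_card_filter]
    congr 1
    refine Multiset.filter_congr fun x _ => ?_
    rw [eq_comm]
    exact QuotientAddGroup.eq_zero_iff x
  rwa [e, e] at h1

theorem countP_twoSaturation_of_map_double_eq {G : Type*} [AddCommGroup G] {C : Multiset G}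
    (hC : (C.map fun a => a + a) = C) (H : AddSubgroup G) [DecidablePred (· ∈ H)]
    [DecidablePred (· ∈ H.twoSaturation)] :
    C.countP (· ∈ H.twoSaturation) = C.countP (· ∈ H) := by
  have h1 : C.filter (fun c => c ∈ H) = C.filter (fun c => c + c ∈ H) := by
    refine Multiset.eq_of_le_of_card_le
      (Multiset.monotone_filter_right _ fun c hc => H.add_mem hc hc) ?_
    rw [← Multiset.countP_eq_card_filter, ← Multiset.countP_eq_card_filter]
    conv_rhs => rw [← hC]
    rw [Multiset.countP_map, Multiset.countP_eq_card_filter]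
  have h2 : ∀ c ∈ C, c + c ∈ H → c ∈ H := fun c hc hcc =>
    (Multiset.mem_filter.1 (h1 ▸ Multiset.mem_filter.2 ⟨hc, hcc⟩ : c ∈ C.filter (· ∈ H))).2
  have h3 : ∀ (k : ℕ), ∀ c ∈ C, 2 ^ k • c ∈ H → c ∈ H := by
    intro k
    induction k with
    | zero => intro c _ hc; simpa using hc
    | succ k ih =>
      intro c hc hk
      refine h2 c hc (ih (c + c) ?_ ?_)
      · rw [← hC]
        exact Multiset.mem_map_of_mem (fun a => a + a) hc
      · rwa [← two_nsmul, ← mul_nsmul, ← pow_succ']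
  refine Multiset.countP_congr rfl fun c hc => ?_
  exact propext ⟨fun ⟨k, hk⟩ => h3 k c hc hk, fun h => ⟨0, by simpa using h⟩⟩

theorem countP_eq_of_FS_eq {G : Type*} [AddCommGroup G]
    (h2 : ∀ g : G, g + g = 0 → g = 0) {A B : Multiset G} (h : FS A = FS B)
    (H : AddSubgroup G) [DecidablePred (· ∈ H)] : A.countP (· ∈ H) = B.countP (· ∈ H) := by
  classical
  have h1 := (map_add_eq_iff_forall_count (double_injective h2) _ _).1
    (map_double_add_eq_of_FS_eq h2 h)
  have h3 := countP_twoSaturation_eq_of_FS_eq h H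
  have hneg : ∀ (K : AddSubgroup G) [DecidablePred (· ∈ K)] (X : Multiset G),
      (X + X.map Neg.neg).countP (· ∈ K) = 2 * X.countP (· ∈ K) := by
    intro K _ X
    rw [Multiset.countP_add, Multiset.countP_map, two_mul, Multiset.countP_eq_card_filter]
    simp
  have hA := hneg H A
  have hB := hneg H B
  have hA2 := hneg H.twoSaturation A
  have hB2 := hneg H.twoSaturation B
  generalize A + A.map Neg.neg = X at *
  generalize B + B.map Neg.neg = Y at *
  have h4 := countP_twoSaturation_of_map_double_eq
    (map_sub_eq_of_forall_count (double_injective h2) h1) H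
  have h5 := countP_twoSaturation_of_map_double_eq
    (map_sub_eq_of_forall_count (X := Y) (Y := X) (double_injective h2)
      fun g => by have := h1 g; omega) H
  have h6 := congrArg (Multiset.countP (· ∈ H)) (sub_add_eq_sub_add X Y)
  have h7 := congrArg (Multiset.countP (· ∈ H.twoSaturation)) (sub_add_eq_sub_add X Y)
  rw [Multiset.countP_add, Multiset.countP_add] at h6 h7
  omega

theorem log_norm_one_add_eq {n : ℕ} (hn : Odd n) {z : ℂ} (hz : z ^ n = 1) :
    Real.log ‖1 + z‖ =
      Real.log ‖1 - z ^ 2‖ - Real.log ‖1 - z‖ + if z = 1 then Real.log 2 else 0 := by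
  by_cases h : z = 1
  · subst h
    norm_num
  · have h1 : 1 - z ≠ 0 := sub_ne_zero.2 (Ne.symm h)
    have h2 : 1 + z ≠ 0 := fun h0 =>
      one_add_ne_zero_of_pow_eq_one hn hz (by linear_combination h0)
    have h3 : 1 - z ^ 2 = (1 - z) * (1 + z) := by ring
    rw [if_neg h, h3, norm_mul, Real.log_mul (norm_ne_zero_iff.2 h1) (norm_ne_zero_iff.2 h2)]
    ring

theorem prod_one_add_ne_zero {G : Type*} {n : ℕ} (hn : Odd n) {w : G → ℂ} (hw : ∀ a, w a ^ n = 1)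
    (A : Multiset G) : (A.map fun a => 1 + w a).prod ≠ 0 := by
  refine Multiset.prod_ne_zero fun h => ?_
  obtain ⟨a, -, ha⟩ := Multiset.mem_map.1 h
  exact one_add_ne_zero_of_pow_eq_one hn (hw a) (by linear_combination ha)

theorem log_norm_prod_one_add {G : Type*} [AddCommGroup G] {n : ℕ} (hn : Odd n)
    (χ : AddChar G ℂ) (hχ : ∀ a, χ a ^ n = 1) (A : Multiset G) :
    2 * Real.log ‖(A.map fun a => 1 + χ a).prod‖ =
      (((A + A.map Neg.neg).map fun a => a + a).map fun a => Real.log ‖1 - χ a‖).sum -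
      ((A + A.map Neg.neg).map fun a => Real.log ‖1 - χ a‖).sum +
      2 * (A.countP fun a => χ a = 1) * Real.log 2 := by
  have hneg : ∀ a, ‖1 - χ (-a)‖ = ‖1 - χ a‖ := by
    intro a
    have hn0 : n ≠ 0 := by rintro rfl; simp at hn
    have h1 := Complex.norm_eq_one_of_pow_eq_one (hχ a) hn0
    have h2 : χ a ≠ 0 := by
      intro h0
      simp [h0] at h1
    rw [AddChar.map_neg_eq_inv, ← one_mul ‖1 - (χ a)⁻¹‖, ← h1, ← norm_mul, mul_sub,
      mul_inv_cancel₀ h2, mul_one, norm_sub_rev]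
  induction A using Multiset.induction_on with
  | empty => simp
  | cons a A ih =>
    have h1 : 1 + χ a ≠ 0 := fun h0 =>
      one_add_ne_zero_of_pow_eq_one hn (hχ a) (by linear_combination h0)
    rw [Multiset.map_cons, Multiset.prod_cons, norm_mul, Real.log_mul (norm_ne_zero_iff.2 h1)
      (norm_ne_zero_iff.2 (prod_one_add_ne_zero hn hχ A)), mul_add, ih,
      log_norm_one_add_eq hn (hχ a)]
    have hd : χ (a + a) = χ a ^ 2 := by rw [AddChar.map_add_eq_mul, sq]
    have hd' : ‖1 - χ (-a + -a)‖ = ‖1 - χ a ^ 2‖ := by rw [← neg_add, hneg, hd]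
    simp only [Multiset.map_cons, Multiset.cons_add, Multiset.add_cons, Multiset.sum_cons,
      Multiset.countP_cons, hd, hd', hneg]
    split_ifs <;> push_cast <;> ring

theorem norm_prod_one_add_eq {G : Type*} [AddCommGroup G] {n : ℕ} (hn : Odd n)
    (χ : AddChar G ℂ) (hχ : ∀ a, χ a ^ n = 1) {A B : Multiset G}
    (h : (A + A.map Neg.neg).map (fun a => a + a) + (B + B.map Neg.neg) =
      (A + A.map Neg.neg) + (B + B.map Neg.neg).map (fun a => a + a))
    (hker : (A.countP fun a => χ a = 1) = B.countP fun a => χ a = 1) :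
    ‖(A.map fun a => 1 + χ a).prod‖ = ‖(B.map fun a => 1 + χ a).prod‖ := by
  have hA := log_norm_prod_one_add hn χ hχ A
  have hB := log_norm_prod_one_add hn χ hχ B
  have hl := congrArg (fun X : Multiset G => (X.map fun a => Real.log ‖1 - χ a‖).sum) h
  generalize A + A.map Neg.neg = X at *
  generalize B + B.map Neg.neg = Y at *
  simp only [Multiset.map_add _ (Multiset.map _ X), Multiset.map_add _ X, Multiset.sum_add] at hl
  rw [hker] at hA
  refine Real.log_injOn_pos (norm_pos_iff.2 (prod_one_add_ne_zero hn hχ A))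
    (norm_pos_iff.2 (prod_one_add_ne_zero hn hχ B)) ?_
  linarith

theorem conj_prod_one_add_mul {G : Type*} [AddCommGroup G] {n : ℕ} (hn : n ≠ 0)
    (χ : AddChar G ℂ) (hχ : ∀ a, χ a ^ n = 1) (A : Multiset G) :
    (starRingEnd ℂ) (A.map fun a => 1 + χ a).prod * χ A.sum = (A.map fun a => 1 + χ a).prod := by
  induction A using Multiset.induction_on with
  | empty => simp
  | cons a A ih =>
    have h1 := Complex.norm_eq_one_of_pow_eq_one (hχ a) hn
    have h2 : (starRingEnd ℂ) (χ a) * χ a = 1 := by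
      rw [mul_comm, Complex.mul_conj, Complex.normSq_eq_norm_sq, h1]
      simp
    rw [Multiset.map_cons, Multiset.prod_cons, Multiset.sum_cons, AddChar.map_add_eq_mul, map_mul,
      map_add, map_one]
    linear_combination (1 + χ a) * ih +
      (starRingEnd ℂ) (A.map fun a => 1 + χ a).prod * χ A.sum * h2

theorem prod_one_add_eq_or_eq_neg {G : Type*} [AddCommGroup G] {n : ℕ} (hn : Odd n)
    (χ : AddChar G ℂ) (hχ : ∀ a, χ a ^ n = 1) {A B : Multiset G}
    (h : (A + A.map Neg.neg).map (fun a => a + a) + (B + B.map Neg.neg) =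
      (A + A.map Neg.neg) + (B + B.map Neg.neg).map (fun a => a + a))
    (hker : (A.countP fun a => χ a = 1) = B.countP fun a => χ a = 1) (hsum : A.sum = B.sum) :
    (A.map fun a => 1 + χ a).prod = (B.map fun a => 1 + χ a).prod ∨
      (A.map fun a => 1 + χ a).prod = -(B.map fun a => 1 + χ a).prod := by
  have hn0 : n ≠ 0 := by rintro rfl; simp at hn
  have h1 := norm_prod_one_add_eq hn χ hχ h hker
  have hA := conj_prod_one_add_mul hn0 χ hχ A
  have hB := conj_prod_one_add_mul hn0 χ hχ B
  rw [hsum] at hA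
  refine sq_eq_sq_iff_eq_or_eq_neg.1 ?_
  have hA2 := Complex.mul_conj' (A.map fun a => 1 + χ a).prod
  have hB2 := Complex.mul_conj' (B.map fun a => 1 + χ a).prod
  rw [h1] at hA2
  generalize (A.map fun a => 1 + χ a).prod = P at *
  generalize (B.map fun a => 1 + χ a).prod = R at *
  linear_combination -P * hA + R * hB + χ B.sum * (hA2 - hB2)

/-- The subring of `ℕ → ℂ` generated by the geometric progressions `j ↦ z ^ j`, `z ^ n = 1`. -/
def powSubring (n : ℕ) : Subring (ℕ → ℂ) :=
  Subring.closure {F | ∃ z : ℂ, z ^ n = 1 ∧ F = fun j => z ^ j}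

theorem pow_mem_powSubring {n : ℕ} {z : ℂ} (hz : z ^ n = 1) :
    (fun j => z ^ j) ∈ powSubring n := Subring.subset_closure ⟨z, hz, rfl⟩

theorem exists_sum_range_eq_of_mem_powSubring {n : ℕ} {F : ℕ → ℂ} (hF : F ∈ powSubring n) :
    ∃ m : ℤ, ∑ j ∈ Finset.range n, F j = n * m := by
  let M : Submonoid (ℕ → ℂ) :=
    { carrier := {F | ∃ z : ℂ, z ^ n = 1 ∧ F = fun j => z ^ j}
      one_mem' := ⟨1, one_pow n, by ext; simp⟩
      mul_mem' := by
        rintro _ _ ⟨z, hz, rfl⟩ ⟨w, hw, rfl⟩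
        exact ⟨z * w, by rw [mul_pow, hz, hw, one_mul], by ext; simp [mul_pow]⟩ }
  rw [powSubring, Subring.mem_closure_iff] at hF
  have hM : (Submonoid.closure {F : ℕ → ℂ | ∃ z : ℂ, z ^ n = 1 ∧ F = fun j => z ^ j}) = M :=
    Submonoid.closure_eq M
  rw [hM] at hF
  induction hF using AddSubgroup.closure_induction with
  | mem F hF =>
    obtain ⟨z, hz, rfl⟩ := hF
    by_cases h1 : z = 1
    · exact ⟨1, by simp [h1]⟩
    · refine ⟨0, ?_⟩
      rw [geom_sum_eq h1, hz]
      simp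
  | zero => exact ⟨0, by simp⟩
  | add F F' _ _ h h' =>
    obtain ⟨m, hm⟩ := h
    obtain ⟨m', hm'⟩ := h'
    refine ⟨m + m', ?_⟩
    simp only [Pi.add_apply, Finset.sum_add_distrib, hm, hm']
    push_cast
    ring
  | neg F _ h =>
    obtain ⟨m, hm⟩ := h
    refine ⟨-m, ?_⟩
    simp only [Pi.neg_apply, Finset.sum_neg_distrib, hm]
    push_cast
    ring

theorem multiset_prod_map_apply {G : Type*} (A : Multiset G) (F : G → ℕ → ℂ) (j : ℕ) :
    (A.map F).prod j = (A.map fun a => F a j).prod := by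
  induction A using Multiset.induction_on with
  | empty => simp
  | cons a A ih => simp [ih]

theorem eq_of_forall_eq_or_eq_neg {n : ℕ} (hn : Odd n) {F : ℕ → ℂ} (hF : F ∈ powSubring n) (l : ℕ)
    (h : ∀ j, F j = 2 ^ l ∨ F j = -2 ^ l) (h0 : F 0 = 2 ^ l) {j : ℕ} (hj : j < n) :
    F j = 2 ^ l := by
  classical
  obtain ⟨m, hm⟩ := exists_sum_range_eq_of_mem_powSubring hF
  set E := (Finset.range n).filter fun j => F j ≠ 2 ^ l with hE
  have hF' : ∀ j, F j = 2 ^ l - 2 ^ (l + 1) * if F j ≠ 2 ^ l then 1 else 0 := by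
    intro j
    by_cases hj : F j = 2 ^ l
    · simp [hj]
    · rw [if_pos hj, (h j).resolve_left hj]
      ring
  rw [Finset.sum_congr rfl fun j _ => hF' j, Finset.sum_sub_distrib, ← Finset.mul_sum,
    Finset.sum_boole, ← hE] at hm
  simp only [Finset.sum_const, Finset.card_range, nsmul_eq_mul] at hm
  have hm' : (n : ℤ) * (2 ^ l - m) = 2 ^ (l + 1) * E.card := by
    have : (n : ℂ) * (2 ^ l - m) = 2 ^ (l + 1) * E.card := by linear_combination hm
    exact_mod_cast this
  have hdvd : n ∣ 2 ^ (l + 1) * E.card :=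
    Int.natCast_dvd_natCast.1 ⟨2 ^ l - m, by push_cast; exact hm'.symm⟩
  have hdvd' : n ∣ E.card :=
    (Nat.Coprime.pow_right _ (Nat.coprime_two_right.2 hn)).dvd_of_dvd_mul_left hdvd
  have hlt : E.card < n := by
    have hss : E ⊂ Finset.range n := by
      refine Finset.filter_ssubset.2 ⟨0, Finset.mem_range.2 (by omega), ?_⟩
      simp [h0]
    simpa using Finset.card_lt_card hss
  have hcard := Nat.eq_zero_of_dvd_of_lt hdvd' hlt
  by_contra hcon
  have : j ∈ E := Finset.mem_filter.2 ⟨Finset.mem_range.2 hj, hcon⟩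
  rw [Finset.card_eq_zero] at hcard
  simp [hcard] at this

theorem one_add_mul_geom_sum_neg {n : ℕ} (hn : Odd n) {z : ℂ} (hz : z ^ n = 1) :
    (1 + z) * ∑ i ∈ Finset.range n, (-z) ^ i = 2 := by
  have h := mul_neg_geom_sum (-z) n
  rw [hn.neg_pow, hz] at h
  linear_combination h

theorem prod_one_add_eq {G : Type*} [AddCommGroup G] {n : ℕ} (hn : Odd n)
    (χ : AddChar G ℂ) (hχ : ∀ a, χ a ^ n = 1) {A B : Multiset G}
    (h : (A + A.map Neg.neg).map (fun a => a + a) + (B + B.map Neg.neg) =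
      (A + A.map Neg.neg) + (B + B.map Neg.neg).map (fun a => a + a))
    (hker : ∀ ψ : AddChar G ℂ, (A.countP fun a => ψ a = 1) = B.countP fun a => ψ a = 1)
    (hsum : A.sum = B.sum) :
    (A.map fun a => 1 + χ a).prod = (B.map fun a => 1 + χ a).prod := by
  let F : ℕ → ℂ := (A.map fun a => (1 + fun j => χ a ^ j : ℕ → ℂ)).prod *
    (B.map fun a => ∑ i ∈ Finset.range n, (-fun j => χ a ^ j : ℕ → ℂ) ^ i).prod
  have hpow : ∀ j a, (χ a ^ j) ^ n = 1 := fun j a => by rw [pow_right_comm, hχ, one_pow]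
  have hF : F ∈ powSubring n := by
    refine mul_mem (multiset_prod_mem _ fun f hf => ?_) (multiset_prod_mem _ fun f hf => ?_)
    · obtain ⟨a, -, rfl⟩ := Multiset.mem_map.1 hf
      exact add_mem (one_mem _) (pow_mem_powSubring (hχ a))
    · obtain ⟨a, -, rfl⟩ := Multiset.mem_map.1 hf
      exact sum_mem fun i _ => pow_mem (neg_mem (pow_mem_powSubring (hχ a))) i
  have hFj : ∀ j, F j = (A.map fun a => 1 + χ a ^ j).prod *
      (B.map fun a => ∑ i ∈ Finset.range n, (-χ a ^ j) ^ i).prod := by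
    intro j
    simp only [F, Pi.mul_apply, multiset_prod_map_apply, Pi.add_apply, Pi.one_apply,
      Finset.sum_apply, Pi.pow_apply, Pi.neg_apply]
  have hB : ∀ j, (B.map fun a => 1 + χ a ^ j).prod *
      (B.map fun a => ∑ i ∈ Finset.range n, (-χ a ^ j) ^ i).prod = 2 ^ B.card := by
    intro j
    rw [← Multiset.prod_map_mul, Multiset.map_congr rfl fun a _ =>
      one_add_mul_geom_sum_neg hn (hpow j a)]
    simp
  have hcard : A.card = B.card := by
    have := hker 1
    simpa using this
  have hsign : ∀ j, F j = 2 ^ B.card ∨ F j = -2 ^ B.card := by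
    intro j
    rw [hFj, ← hB j, ← neg_mul]
    have := prod_one_add_eq_or_eq_neg hn (χ ^ j) (by simpa using hpow j) h (hker _) hsum
    simp only [AddChar.pow_apply] at this
    exact this.imp (congrArg (· * _)) (congrArg (· * _))
  have h0 : F 0 = 2 ^ B.card := by
    rw [hFj, ← hB 0]
    simp [hcard]
  have h1 := eq_of_forall_eq_or_eq_neg hn hF B.card hsign h0 (Nat.mod_lt 1 hn.pos)
  rw [hFj, ← hB (1 % n)] at h1
  have h2 := mul_right_cancel₀ (right_ne_zero_of_mul (by rw [hB]; exact pow_ne_zero _ two_ne_zero)) h1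
  simpa only [← pow_eq_pow_mod 1 (hχ _), pow_one] using h2

theorem FS_eq_of_map_double_add_eq {G : Type*} [AddCommGroup G]
    (h2 : ∀ g : G, g + g = 0 → g = 0) {A B : Multiset G}
    (h : (A + A.map Neg.neg).map (fun a => a + a) + (B + B.map Neg.neg) =
      (A + A.map Neg.neg) + (B + B.map Neg.neg).map (fun a => a + a))
    (hH : ∀ (H : AddSubgroup G) [DecidablePred (· ∈ H)],
      A.countP (· ∈ H) = B.countP (· ∈ H))
    (hsum : A.sum = B.sum) : FS A = FS B := by
  classical
  obtain ⟨K, Q, _, _, φ, hQ, hK, hφ⟩ := exists_odd_finite_quotient_injOn h2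
    (A + B + (FS A + FS B)).toFinset
  obtain ⟨A, rfl⟩ := exists_eq_map_val K A fun a ha => hK a (by simp [ha])
  obtain ⟨B, rfl⟩ := exists_eq_map_val K B fun a ha => hK a (by simp [ha])
  rw [FS_map, FS_map, ← Multiset.map_add _ (FS A)] at hφ
  rw [FS_map, FS_map]
  congr 1
  have e : ∀ {M : Type _} [AddCommGroup M] (ψ : K →+ M) (A B : Multiset K),
      (A.map ψ + (A.map ψ).map Neg.neg).map (fun a => a + a) + (B.map ψ + (B.map ψ).map Neg.neg)
      = ((A + A.map Neg.neg).map (fun a => a + a) + (B + B.map Neg.neg)).map ψ := by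
    intro M _ ψ A B
    simp [Multiset.map_map]
  have hKeq : (A + A.map Neg.neg).map (fun a => a + a) + (B + B.map Neg.neg) =
      (A + A.map Neg.neg) + (B + B.map Neg.neg).map (fun a => a + a) := by
    rw [add_comm (_ + _) (Multiset.map _ _), e, e] at h
    rw [add_comm (_ + _) (Multiset.map _ _)]
    exact Multiset.map_injective Subtype.val_injective h
  have hsumK : A.sum = B.sum := by
    rw [sum_map_addMonoidHom, sum_map_addMonoidHom] at hsum
    exact Subtype.ext hsum
  refine Multiset.eq_of_map_eq_of_injOn (f := φ) (fun x y hx hy => hφ x y ?_ ?_) ?_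
  · exact Multiset.mem_toFinset.2 (Multiset.mem_add.2 (.inr (Multiset.mem_map_of_mem _ hx)))
  · exact Multiset.mem_toFinset.2 (Multiset.mem_add.2 (.inr (Multiset.mem_map_of_mem _ hy)))
  rw [← FS_map, ← FS_map]
  refine eq_of_sum_addChar_eq fun ψ => ?_
  rw [sum_map_FS, sum_map_FS]
  refine prod_one_add_eq hQ ψ (addChar_pow_card ψ) ?_ (fun ψ => ?_) ?_
  · rw [add_comm (_ + _) (Multiset.map _ _), e, e, hKeq, add_comm]
  · have := hH (((AddChar.toAddMonoidHom ψ).comp φ).ker.map K.subtype)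
    have e' : ∀ X : Multiset K, (X.map K.subtype).countP
        (· ∈ ((AddChar.toAddMonoidHom ψ).comp φ).ker.map K.subtype) =
        (X.map φ).countP fun a => ψ a = 1 := by
      intro X
      simp only [Multiset.countP_map]
      congr 1
      refine Multiset.filter_congr fun x _ => ?_
      rw [AddSubgroup.mem_map]
      refine ⟨?_, fun hx => ⟨x, hx, rfl⟩⟩
      rintro ⟨y, hy, hxy⟩
      obtain rfl : y = x := Subtype.ext hxy
      exact hy
    rwa [e', e'] at this
  · rw [sum_map_addMonoidHom, sum_map_addMonoidHom, hsumK]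

end

theorem stmt1 {G : Type*} [AddCommGroup G] [DecidableEq G]
    (h2 : ∀ g : G, g + g = 0 → g = 0) (A B : Multiset G) :
    FS A = FS B ↔
      (memV (fun g => (A.count g : ℤ) - (B.count g : ℤ)) ∧
        ∑ᶠ g : G, ((A.count g : ℤ) - (B.count g : ℤ)) • g = 0) := by
  have hsum := finsum_count_sub_count_smul A B id
  simp only [id_eq, Multiset.map_id'] at hsum
  rw [memV_count_sub_count_iff h2, hsum, sub_eq_zero]
  exact ⟨fun h => ⟨⟨map_double_add_eq_of_FS_eq h2 h, fun H _ => countP_eq_of_FS_eq h2 h H⟩,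
    sum_eq_of_FS_eq h2 h⟩, fun h => FS_eq_of_map_double_add_eq h2 h.1.1 h.1.2 h.2⟩
end

section
/- Let G₁, G₂ be abelian groups with no elements of order 2, and let ψ : G₁ → G₂ be a group homomorphism. If μ ∈ V(G₁), then the pushforward ψ_*μ, defined by ψ_*μ(g₂) := Σ_{g₁ ∈ ψ^{−1}(g₂)} μ(g₁), belongs to V(G₂). -/
open scoped BigOperators

/-- The total mass of a pushforward on a set is the mass on the preimage. -/
theorem finsum_mem_pushforward {α β M : Type*} [AddCommMonoid M] (f : α → β) (μ : α → M)
    (hμ : (Function.support μ).Finite) (s : Set β) :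
    ∑ᶠ b ∈ s, ∑ᶠ a ∈ f ⁻¹' {b}, μ a = ∑ᶠ a ∈ f ⁻¹' s, μ a := by
  have hfib : ∀ b, ∑ᶠ a ∈ f ⁻¹' {b}, μ a = ∑ᶠ a ∈ f ⁻¹' {b} ∩ Function.support μ, μ a :=
    fun b => (finsum_mem_inter_support μ _).symm
  have hs : ∑ᶠ b ∈ s, ∑ᶠ a ∈ f ⁻¹' {b}, μ a
      = ∑ᶠ b ∈ s ∩ f '' Function.support μ, ∑ᶠ a ∈ f ⁻¹' {b}, μ a := by
    refine finsum_mem_inter_support_eq' _ _ _ fun b hb => ?_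
    obtain ⟨a, ha, hne⟩ := exists_ne_zero_of_finsum_mem_ne_zero hb
    exact ⟨fun h => ⟨h, a, hne, ha⟩, fun h => h.1⟩
  rw [hs, finsum_congr fun b => by rw [hfib b], ← finsum_mem_biUnion,
    ← finsum_mem_inter_support μ (f ⁻¹' s)]
  · congr! 3 with a
    simp only [Set.mem_iUnion, Set.mem_inter_iff, Set.mem_preimage, Set.mem_singleton_iff,
      exists_prop]
    exact ⟨fun ⟨b, hb, hab, ha⟩ => ⟨hab ▸ hb.1, ha⟩,
      fun ⟨hs, ha⟩ => ⟨f a, ⟨hs, a, ha, rfl⟩, rfl, ha⟩⟩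
  · intro b _ c _ hbc
    refine Set.disjoint_left.2 fun a hb hc => hbc ?_
    exact hb.1.symm.trans hc.1
  · exact (hμ.image f).subset Set.inter_subset_right
  · exact fun b _ => hμ.subset Set.inter_subset_right

theorem add_self_injective {G : Type*} [AddCommGroup G] (h : ∀ g : G, g + g = 0 → g = 0) :
    Function.Injective fun g : G => g + g := by
  intro a b hab
  refine sub_eq_zero.1 (h _ ?_)
  rw [sub_add_sub_comm]
  exact sub_eq_zero.2 hab

/-- The pushforward of a finitely supported doubling-invariant function is doubling-invariant. -/
theorem finsum_mem_preimage_add_self {G₁ G₂ M : Type*} [AddCommGroup G₁] [AddCommGroup G₂]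
    [AddCommMonoid M]
    (h1 : ∀ g : G₁, g + g = 0 → g = 0) (h2 : ∀ g : G₂, g + g = 0 → g = 0)
    (ψ : G₁ →+ G₂) (ν : G₁ → M) (hν : (Function.support ν).Finite)
    (hd : ∀ g, ν g = ν (g + g)) (h : G₂) :
    ∑ᶠ g ∈ ψ ⁻¹' {h}, ν g = ∑ᶠ g ∈ ψ ⁻¹' {h + h}, ν g := by
  have hmaps : Set.MapsTo (fun g : G₁ => g + g) (Function.support ν) (Function.support ν) := by
    intro g hg
    rwa [Function.mem_support, ← hd]
  have hsurj : Set.SurjOn (fun g : G₁ => g + g) (Function.support ν) (Function.support ν) := by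
    simpa using Finset.surjOn_of_injOn_of_card_le (s := hν.toFinset) (t := hν.toFinset) _
      (by simpa using hmaps) (add_self_injective h1).injOn le_rfl
  rw [← finsum_mem_inter_support ν, ← finsum_mem_inter_support ν (ψ ⁻¹' {h + h})]
  refine finsum_mem_eq_of_bijOn (fun g => g + g) ⟨?_, (add_self_injective h1).injOn, ?_⟩
    fun g _ => hd g
  · rintro g ⟨hg, hs⟩
    have hg : ψ g = h := hg
    exact ⟨by simp [hg], hmaps hs⟩
  · rintro g ⟨hg, hs⟩
    obtain ⟨k, hk, rfl⟩ := hsurj hs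
    have hg : ψ (k + k) = h + h := hg
    rw [map_add] at hg
    exact ⟨k, ⟨add_self_injective h2 hg, hk⟩, rfl⟩

theorem finsum_mem_preimage_neg {G₁ G₂ M : Type*} [AddCommGroup G₁] [AddCommGroup G₂]
    [AddCommMonoid M] (ψ : G₁ →+ G₂) (μ : G₁ → M) (h : G₂) :
    ∑ᶠ g ∈ ψ ⁻¹' {-h}, μ g = ∑ᶠ g ∈ ψ ⁻¹' {h}, μ (-g) := by
  refine finsum_mem_eq_of_bijOn (fun g => -g) ⟨?_, neg_injective.injOn, ?_⟩ fun g _ => by simp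
  · intro g hg
    have hg : ψ g = -h := hg
    simp [hg]
  · intro g hg
    have hg : ψ g = h := hg
    exact ⟨-g, by simp [hg], neg_neg g⟩

theorem stmt6 {G₁ G₂ : Type*} [AddCommGroup G₁] [AddCommGroup G₂]
    (h1 : ∀ g : G₁, g + g = 0 → g = 0) (h2 : ∀ g : G₂, g + g = 0 → g = 0)
    (ψ : G₁ →+ G₂) (μ : G₁ → ℤ) (hμ : memV μ) :
    memV (fun g₂ : G₂ => ∑ᶠ g₁ ∈ ⇑ψ ⁻¹' {g₂}, μ g₁) := by
  obtain ⟨hfin, hd, hsum⟩ := hμ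
  have hneg : (Function.support fun g => μ (-g)).Finite :=
    hfin.preimage neg_injective.injOn
  refine ⟨(hfin.image ψ).subset fun b hb => ?_, fun g => ?_, fun H => ?_⟩
  · obtain ⟨a, ha, hne⟩ := exists_ne_zero_of_finsum_mem_ne_zero hb
    exact ⟨a, hne, ha⟩
  · have hadd : ∀ h : G₂, ∑ᶠ g ∈ ψ ⁻¹' {h}, μ g + ∑ᶠ g ∈ ψ ⁻¹' {-h}, μ g
        = ∑ᶠ g ∈ ψ ⁻¹' {h}, (μ g + μ (-g)) := fun h => by
      rw [finsum_mem_preimage_neg, finsum_mem_add_distrib' (hfin.subset Set.inter_subset_right)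
        (hneg.subset Set.inter_subset_right)]
    simp only [hadd]
    exact finsum_mem_preimage_add_self h1 h2 ψ (fun g => μ g + μ (-g))
      ((hfin.union hneg).subset (Function.support_add _ _)) hd g
  · rw [finsum_mem_pushforward ψ μ hfin]
    exact hsum (H.comap ψ)
end
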